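/- arXiv:math/0209249 — 8 statements merged into one kernel-verified Lean document; each statement's English description precedes it below -/
import Mathlib

section
/- For any positive integers i_1, i_2, ..., i_{n+1}, let N be the n×n matrix with N(r,s) = i_1 when s = 1 and N(r,s) = Σ_{m=1}^{min(r,s)+1} i_m when s ≥ 2; then the determinant of N equals i_1 · i_3 · i_4 · ... · i_{n+1}. -/
/-- For any positive integers `i 0, …, i n` (representing `i_1, …, i_{n+1}`), the determinant
of the `n × n` matrix `Θ_n` whose first-column entries all equal `i_1` and whose `(r, s)`
entry for `s ≥ 2` (1-indexed) is `i_1 + ⋯ + i_{min(r,s)+1}` equals `i_1 · i_3 · i_4 ⋯ i_{n+1}`. -/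
theorem det_theta_matrix (n : ℕ) (hn : 0 < n) (i : ℕ → ℤ) (hi : ∀ m, 0 < i m) :
    (Matrix.of fun r s : Fin n =>
        if s.val = 0 then i 0
        else ∑ m ∈ Finset.range (min r.val s.val + 2), i m).det
      = i 0 * ∏ m ∈ Finset.Ico 2 (n + 1), i m := by
  obtain ⟨k, rfl⟩ := Nat.exists_eq_succ_of_ne_zero hn.ne'
  rw [Matrix.det_eq_of_forall_row_eq_smul_add_pred
    (B := Matrix.of fun r s : Fin (k + 1) =>
      if r.val = 0 then (if s.val = 0 then i 0 else i 0 + i 1)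
      else if r.val ≤ s.val then i (r.val + 1) else 0) (fun _ => 1)]
  · rw [Matrix.det_of_isUpperTriangular, Fin.prod_univ_succ]
    · simp [Finset.prod_Ico_eq_prod_range, Finset.prod_range, add_comm, add_left_comm]
    · intro r s hrs
      have h : s.val < r.val := hrs
      simp only [Matrix.of_apply]
      rw [if_neg (by omega), if_neg (by omega)]
  · intro s
    simp [Finset.sum_range_succ]
  · intro r s
    simp only [Matrix.of_apply, Fin.val_succ, Fin.val_castSucc]
    by_cases hs : s.val = 0
    · simp [hs]
    by_cases hr : r.val + 1 ≤ s.val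
    · simp [hs, hr, Nat.le_of_succ_le hr, Finset.sum_range_succ _ (r.val + 2),
        show r.val + 1 + 2 = r.val + 2 + 1 by omega]
      ring_nf
    · simp [hs, hr, min_eq_right (show s.val ≤ r.val + 1 by omega),
        min_eq_right (show s.val ≤ r.val by omega)]
end

section
/- For every positive integer n and every integer k with 0 ≤ k ≤ n, the sum of the determinants of all k×k principal submatrices of the n×n matrix A_n with entries a_{ij} = min(i,j) equals the binomial coefficient C(n+k, n−k). -/
/-- The determinant of the matrix `min (f i + 1) (f j + 1)` attached to a finite family of
natural numbers. -/
def minDet {ι : Type*} [Fintype ι] [DecidableEq ι] (f : ι → ℕ) : ℤ :=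
  (Matrix.of fun i j : ι => (min (f i + 1) (f j + 1) : ℤ)).det

/-- The principal minor of the matrix `min (i + 1) (j + 1)` on the index set `S`. -/
def principalMinDet (S : Finset ℕ) : ℤ :=
  minDet fun a : {x // x ∈ S} => (a : ℕ)

theorem minDet_comp_equiv {ι κ : Type*} [Fintype ι] [DecidableEq ι] [Fintype κ] [DecidableEq κ]
    (e : ι ≃ κ) (f : κ → ℕ) : minDet (fun i => f (e i)) = minDet f :=
  Matrix.det_submatrix_equiv_self e (Matrix.of fun i j : κ => (min (f i + 1) (f j + 1) : ℤ))

/-- Increasing the corner entry of a matrix by one adds the complementary minor to its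
determinant. -/
theorem Matrix.det_fromBlocks_add_one {ι R : Type*} [Fintype ι] [DecidableEq ι] [CommRing R]
    (A : Matrix ι ι R) (B : Matrix ι Unit R) (C : Matrix Unit ι R) (c : R) :
    (Matrix.fromBlocks A B C (Matrix.of fun _ _ => c + 1)).det =
      (Matrix.fromBlocks A B C (Matrix.of fun _ _ => c)).det + A.det := by
  set M := Matrix.fromBlocks A B C (Matrix.of fun _ _ => c) with hM
  have key : Matrix.fromBlocks A B C (Matrix.of fun _ _ => c + 1) =
      M.updateRow (Sum.inr ()) (M (Sum.inr ()) + Sum.elim (0 : ι → R) (1 : Unit → R)) := by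
    ext i j
    rcases i with i | i <;> rcases j with j | j <;> simp [hM, Matrix.updateRow_apply]
  have corner : M.updateRow (Sum.inr ()) (Sum.elim (0 : ι → R) (1 : Unit → R)) =
      Matrix.fromBlocks A B 0 1 := by
    ext i j
    rcases i with i | i <;> rcases j with j | j <;>
      simp [hM, Matrix.updateRow_apply]
  rw [key, Matrix.det_updateRow_add, Matrix.updateRow_eq_self, corner,
    Matrix.det_fromBlocks_zero₂₁, Matrix.det_one, mul_one]

theorem minDet_sumElim {ι : Type*} [Fintype ι] [DecidableEq ι] (f : ι → ℕ) (m : ℕ) :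
    minDet (ι := ι ⊕ Unit) (Sum.elim f fun _ => m) =
      (Matrix.fromBlocks (Matrix.of fun i j : ι => (min (f i + 1) (f j + 1) : ℤ))
        (Matrix.of fun i (_ : Unit) => (min (f i + 1) (m + 1) : ℤ))
        (Matrix.of fun (_ : Unit) j => (min (m + 1) (f j + 1) : ℤ))
        (Matrix.of fun _ _ : Unit => (m + 1 : ℤ))).det := by
  unfold minDet
  congr 1
  ext i j
  rcases i with i | i <;> rcases j with j | j <;> simp

theorem minDet_sumElim_succ {ι : Type*} [Fintype ι] [DecidableEq ι] (f : ι → ℕ) (m : ℕ)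
    (h : ∀ i, f i ≤ m) :
    minDet (ι := ι ⊕ Unit) (Sum.elim f fun _ => m + 1) =
      minDet (ι := ι ⊕ Unit) (Sum.elim f fun _ => m) + minDet f := by
  rw [minDet_sumElim, minDet_sumElim, minDet, ← Matrix.det_fromBlocks_add_one]
  congr 2
  · ext i j
    have := h i
    simp only [Matrix.of_apply]
    omega
  · ext i j
    have := h j
    simp only [Matrix.of_apply]
    omega

theorem minDet_eq_zero {ι : Type*} [Fintype ι] [DecidableEq ι] (f : ι → ℕ) {i j : ι}
    (hij : i ≠ j) (h : f i = f j) : minDet f = 0 :=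
  Matrix.det_zero_of_row_eq hij (by ext l; simp [h])

theorem principalMinDet_empty : principalMinDet ∅ = 1 :=
  Matrix.det_isEmpty

theorem principalMinDet_singleton (m : ℕ) : principalMinDet {m} = m + 1 := by
  rw [principalMinDet, minDet, Matrix.det_unique, Matrix.of_apply, min_self,
    Finset.mem_singleton.1 (Subtype.prop default)]

theorem principalMinDet_insert {S : Finset ℕ} {m : ℕ} (hm : m ∉ S) :
    principalMinDet (insert m S) =
      minDet (ι := {x // x ∈ S} ⊕ Unit) (Sum.elim (fun a => (a : ℕ)) fun _ => m) := by
  rw [principalMinDet, ← minDet_comp_equiv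
    ((Finset.subtypeInsertEquivOption hm).trans (Equiv.optionEquivSumPUnit _))]
  congr 1
  ext a
  obtain ⟨a, ha⟩ := a
  by_cases h : a = m <;> simp [Finset.subtypeInsertEquivOption, h]

theorem principalMinDet_insert_succ {S : Finset ℕ} {m : ℕ} (h : ∀ a ∈ S, a < m) :
    principalMinDet (insert (m + 1) S) =
      principalMinDet (insert m S) + principalMinDet S := by
  have hm : m ∉ S := fun hm => lt_irrefl _ (h m hm)
  have hm' : m + 1 ∉ S := fun hm => absurd (h _ hm) (by omega)
  rw [principalMinDet_insert hm, principalMinDet_insert hm',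
    minDet_sumElim_succ _ _ fun i : {x // x ∈ S} => (h i i.2).le, principalMinDet]

theorem principalMinDet_insert_succ_insert {S : Finset ℕ} {m : ℕ} (h : ∀ a ∈ S, a < m) :
    principalMinDet (insert (m + 1) (insert m S)) = principalMinDet (insert m S) := by
  have hle : ∀ a ∈ insert m S, a ≤ m := by
    intro a ha
    rcases Finset.mem_insert.1 ha with rfl | ha
    · exact le_rfl
    · exact (h a ha).le
  have hm : m + 1 ∉ insert m S := fun hm => absurd (hle _ hm) (by omega)
  rw [principalMinDet_insert hm,
    minDet_sumElim_succ _ _ fun i : {x // x ∈ insert m S} => hle i i.2,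
    minDet_eq_zero _ (i := Sum.inl ⟨m, Finset.mem_insert_self m S⟩) (j := Sum.inr ())
      (by simp) (by simp), zero_add, principalMinDet]

/-- A sum over the `(k + 1)`-subsets of `range (n + 1)` splits according to whether `n` is
a member. -/
theorem Finset.sum_powersetCard_range_succ {M : Type*} [AddCommMonoid M] (n k : ℕ)
    (g : Finset ℕ → M) :
    ∑ S ∈ Finset.powersetCard (k + 1) (Finset.range (n + 1)), g S =
      ∑ S ∈ Finset.powersetCard (k + 1) (Finset.range n), g S +
        ∑ S ∈ Finset.powersetCard k (Finset.range n), g (insert n S) := by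
  have hn : ∀ {j S}, S ∈ Finset.powersetCard j (Finset.range n) → n ∉ S := fun hS h =>
    Finset.notMem_range_self ((Finset.mem_powersetCard.1 hS).1 h)
  rw [Finset.range_add_one, Finset.powersetCard_succ_insert Finset.notMem_range_self,
    Finset.sum_union, Finset.sum_image]
  · intro S hS T hT hST
    rw [← Finset.erase_insert (hn hS), ← Finset.erase_insert (hn hT), hST]
  · rw [Finset.disjoint_left]
    intro S hS hS'
    obtain ⟨T, -, rfl⟩ := Finset.mem_image.1 hS'
    exact hn hS (Finset.mem_insert_self n T)

theorem sum_principalMinDet_powersetCard_range (n k : ℕ) :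
    ∑ S ∈ Finset.powersetCard k (Finset.range n), principalMinDet S =
        ((n + k).choose (2 * k) : ℤ) ∧
      ∑ S ∈ Finset.powersetCard k (Finset.range n),
        principalMinDet (insert n S) =
          ((n + k + 1).choose (2 * k + 1) : ℤ) := by
  have hlt : ∀ {n j S}, S ∈ Finset.powersetCard j (Finset.range n) → ∀ a ∈ S, a < n :=
    fun hS a ha => Finset.mem_range.1 ((Finset.mem_powersetCard.1 hS).1 ha)
  induction n generalizing k with
  | zero =>
    rcases k with _ | k
    · simp [principalMinDet_singleton, principalMinDet_empty]
    · rw [Finset.powersetCard_eq_empty.2 (by simp)]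
      simp only [Finset.sum_empty]
      constructor <;> rw [Nat.choose_eq_zero_of_lt (by omega)] <;> simp
  | succ n ih =>
    rcases k with _ | k
    · simp [principalMinDet_singleton, principalMinDet_empty]
    · rw [Finset.sum_powersetCard_range_succ, Finset.sum_powersetCard_range_succ,
        Finset.sum_congr rfl fun S hS => principalMinDet_insert_succ (hlt hS),
        Finset.sum_congr (s₁ := Finset.powersetCard k (Finset.range n)) rfl
          fun S hS => principalMinDet_insert_succ_insert (hlt hS),
        Finset.sum_add_distrib, (ih _).1, (ih _).2, (ih _).2]
      have h1 := Nat.choose_succ_succ (n + k + 1) (2 * k + 1)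
      have h2 := Nat.choose_succ_succ (n + k + 2) (2 * k + 2)
      simp only [Nat.succ_eq_add_one] at h1 h2
      constructor
      · norm_cast
        grind
      · norm_cast
        grind

/-- For every positive integer `n` and `0 ≤ k ≤ n`, the sum of the determinants of all
`k × k` principal submatrices of the `n × n` matrix with entries `min(i, j)` equals the
binomial coefficient `C(n + k, n - k)`. -/
theorem sum_principal_minors_min_matrix (n k : ℕ) (hn : 0 < n) (hk : k ≤ n) :
    ∑ S ∈ Finset.powersetCard k (Finset.univ : Finset (Fin n)),
      ((Matrix.of fun i j : Fin n => (min (i.val + 1) (j.val + 1) : ℤ)).submatrix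
        (fun a : {x // x ∈ S} => (a : Fin n)) (fun a : {x // x ∈ S} => (a : Fin n))).det
      = ((n + k).choose (n - k) : ℤ) := by
  have hchoose : (n + k).choose (n - k) = (n + k).choose (2 * k) :=
    Nat.choose_symm_of_eq_add (by omega)
  have hrange : Finset.range n = Finset.univ.map (Fin.valEmbedding (n := n)) := by
    ext a
    simp
  rw [hchoose, ← (sum_principalMinDet_powersetCard_range n k).1, hrange, Finset.powersetCard_map,
    Finset.sum_map]
  refine Finset.sum_congr rfl fun S _ => ?_
  exact minDet_comp_equiv (S.equivMap Fin.valEmbedding)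
    fun a : {x // x ∈ S.map Fin.valEmbedding} => (a : ℕ)
end

section
/- For every positive integer n and every integer k with 0 ≤ k ≤ n, the coefficient of X^{n−k} in the characteristic polynomial of the n×n matrix A_n with entries a_{ij} = min(i,j) equals (−1)^k · C(n+k, n−k). -/
open Polynomial in
/-- The entries of `X T - 1`, where `T` is the inverse of the matrix `min (i + 1) (j + 1)`. -/
noncomputable def minPencil (i j : ℕ) : ℤ[X] :=
  if i = j then (if i = 0 then X - 1 else 2 * X - 1)
  else if i + 1 = j ∨ j + 1 = i then -X else 0

/-- The three-term recurrence for the leading principal minors of a tridiagonal matrix. -/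
theorem Matrix.det_tridiagonal_succ_succ {R : Type*} [CommRing R] (t : ℕ → ℕ → R)
    (ht : ∀ i j, i + 1 < j ∨ j + 1 < i → t i j = 0) (n : ℕ) :
    (Matrix.of fun i j : Fin (n + 2) => t i j).det =
      t (n + 1) (n + 1) * (Matrix.of fun i j : Fin (n + 1) => t i j).det
        - t (n + 1) n * t n (n + 1) * (Matrix.of fun i j : Fin n => t i j).det := by
  have hminor : ((Matrix.of fun i j : Fin (n + 2) => t i j).submatrix Fin.castSucc
      (Fin.last n).castSucc.succAbove).det =
        t n (n + 1) * (Matrix.of fun i j : Fin n => t i j).det := by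
    rw [Matrix.det_succ_column _ (Fin.last n), Fin.sum_univ_castSucc, Finset.sum_eq_zero]
    · have hsub : (((Matrix.of fun i j : Fin (n + 2) => t i j).submatrix Fin.castSucc
          (Fin.last n).castSucc.succAbove).submatrix (Fin.last n).succAbove
          (Fin.last n).succAbove) = Matrix.of fun i j : Fin n => t i j := by
        ext i j
        simp [Fin.succAbove_of_castSucc_lt, Fin.lt_def]
      rw [hsub]
      simp [← two_mul]
    · intro i _
      have : t i (n + 1) = 0 := ht _ _ (Or.inl (by have := i.isLt; omega))
      simp [this]
  rw [Matrix.det_succ_row _ (Fin.last (n + 1)), Fin.sum_univ_castSucc, Fin.sum_univ_castSucc,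
    Finset.sum_eq_zero]
  · have hsub : ((Matrix.of fun i j : Fin (n + 2) => t i j).submatrix Fin.castSucc Fin.castSucc) =
        Matrix.of fun i j : Fin (n + 1) => t i j := by
      ext i j
      simp
    have hsign : (-1 : R) ^ (n + 1 + n) = -1 := Odd.neg_one_pow ⟨n, by ring⟩
    simp only [Fin.succAbove_last, hminor, hsub]
    simp [hsign]
    ring
  · intro j _
    have : t (n + 1) j = 0 := ht _ _ (Or.inr (by have := j.isLt; omega))
    simp [this]

theorem sum_backward_difference {R : Type*} [CommRing R] {n : ℕ} (i : Fin n) (f : ℕ → R) :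
    ∑ k : Fin n, (if i.val = k.val then 1 else if k.val + 1 = i.val then -1 else 0) * f k =
      f i - if i.val = 0 then 0 else f (i - 1) := by
  rw [Fin.sum_univ_eq_sum_range
    (fun k => (if i.val = k then 1 else if k + 1 = i.val then -1 else 0) * f k)]
  have hsplit : ∀ k : ℕ, (if i.val = k then (1 : R) else if k + 1 = i.val then -1 else 0) * f k =
      (if i.val = k then f k else 0) - if k + 1 = i.val then f k else 0 := by
    intro k
    split_ifs <;> first | omega | simp
  simp only [hsplit, Finset.sum_sub_distrib]
  congr 1
  · simp
  · obtain ⟨i, hi⟩ := i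
    cases i with
    | zero => simp
    | succ i =>
      simp
      omega

open Polynomial in
/-- Congruence by the backward difference matrix turns `X - min (i + 1) (j + 1)` into
the tridiagonal pencil `minPencil`. -/
theorem charpoly_min_eq_det_minPencil (n : ℕ) :
    (Matrix.of fun i j : Fin n => (min (i.val + 1) (j.val + 1) : ℤ)).charpoly =
      (Matrix.of fun i j : Fin n => minPencil i j).det := by
  let U : Matrix (Fin n) (Fin n) ℤ[X] :=
    Matrix.of fun i j => if i.val = j.val then 1 else if j.val + 1 = i.val then -1 else 0
  let e : ℕ → ℕ → ℤ[X] := fun i j => (if i = j then X else 0) - ((min (i + 1) (j + 1) : ℕ) : ℤ[X])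
  have hU : U.det = 1 := by
    rw [Matrix.det_of_isLowerTriangular]
    · simp [U]
    · intro i j hij
      have hij : i.val < j.val := hij
      simp only [U, Matrix.of_apply]
      rw [if_neg (by omega), if_neg (by omega)]
  have he : (Matrix.of fun i j : Fin n => (min (i.val + 1) (j.val + 1) : ℤ)).charmatrix =
      Matrix.of fun i j : Fin n => e i j := by
    ext1 i j
    simp [e, Matrix.charmatrix_apply, Matrix.diagonal_apply, Fin.ext_iff, ← Nat.cast_min]
  have hcong : U * (Matrix.of fun i j : Fin n => e i j) * U.transpose =
      Matrix.of fun i j : Fin n => minPencil i j := by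
    ext1 i j
    have hleft : ∀ k : Fin n, (U * Matrix.of fun i j : Fin n => e i j) i k =
        e i k - if i.val = 0 then 0 else e (i - 1) k := fun k =>
      sum_backward_difference i fun l => e l k
    rw [Matrix.mul_apply]
    simp only [hleft, Matrix.transpose_apply]
    simp only [mul_comm _ (U j _)]
    refine (sum_backward_difference j fun l =>
      e i l - if i.val = 0 then 0 else e (i - 1) l).trans ?_
    obtain ⟨i, hi⟩ := i
    obtain ⟨j, hj⟩ := j
    simp only [Matrix.of_apply, minPencil, e]
    rcases i with _ | i <;> rcases j with _ | j
    · simp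
    · rcases j with _ | j <;> grind
    · rcases i with _ | i <;> grind
    · rcases lt_trichotomy i j with h | rfl | h
      · obtain ⟨d, rfl⟩ := Nat.exists_eq_add_of_lt h
        rcases d with _ | d
        · simp
          grind
        · simp
          grind
      · simp
        ring
      · obtain ⟨d, rfl⟩ := Nat.exists_eq_add_of_lt h
        rcases d with _ | d
        · simp
          grind
        · simp
          grind
  rw [Matrix.charpoly, he, ← hcong, Matrix.det_mul, Matrix.det_mul, Matrix.det_transpose, hU]
  simp

theorem choose_succ_succ_three_term (n m : ℕ) :
    (2 * n + 2 - m).choose (m + 2) + (2 * n - m).choose m =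
      2 * (2 * n + 1 - m).choose (m + 1) + (2 * n - m).choose (m + 2) := by
  rcases le_or_gt m (2 * n) with h | h
  · obtain ⟨a, ha⟩ := Nat.exists_eq_add_of_le h
    rw [show 2 * n + 2 - m = a + 2 by omega, show 2 * n - m = a by omega,
      show 2 * n + 1 - m = a + 1 by omega, Nat.choose_succ_succ' (a + 1), Nat.choose_succ_succ' a,
      Nat.choose_succ_succ' a]
    ring
  · repeat rw [Nat.choose_eq_zero_of_lt (by omega)]

open Polynomial in
theorem coeff_det_minPencil (n m : ℕ) :
    ((Matrix.of fun i j : Fin n => minPencil i j).det).coeff m =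
      (-1) ^ (n + m) * ((2 * n - m).choose m : ℤ) := by
  induction n using Nat.twoStepInduction generalizing m with
  | zero =>
    rcases m with _ | m
    · simp
    · simp [coeff_one]
  | one =>
    rcases m with _ | _ | m
    · simp [minPencil]
    · simp [minPencil, coeff_one]
    · simp [minPencil, coeff_one, coeff_X, Nat.choose_eq_zero_of_lt]
  | more n ih₀ ih₁ =>
    rw [Matrix.det_tridiagonal_succ_succ minPencil
      (fun i j h => by rw [minPencil, if_neg (by omega), if_neg (by omega)])]
    have hrec : ∀ p q : ℤ[X], minPencil (n + 1) (n + 1) * p -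
        minPencil (n + 1) n * minPencil n (n + 1) * q = 2 * (p * X) - p - q * X ^ 2 := by
      intro p q
      simp [minPencil]
      ring
    rw [hrec, coeff_sub, coeff_sub, coeff_ofNat_mul, ih₁, coeff_mul_X_pow']
    rcases m with _ | _ | m
    · simp
      ring
    · simp [ih₁]
      ring
    · rw [coeff_mul_X, ih₁, if_pos (by omega), show m + 1 + 1 - 2 = m by omega, ih₀]
      have h := choose_succ_succ_three_term n m
      rw [show 2 * (n + 1) - (m + 1) = 2 * n + 1 - m by omega,
        show 2 * (n + 1) - (m + 1 + 1) = 2 * n - m by omega,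
        show 2 * (n + 2) - (m + 1 + 1) = 2 * n + 2 - m by omega]
      zify at h
      linear_combination (-1 : ℤ) ^ (n + m + 1) * h

/-- For every positive integer `n` and `0 ≤ k ≤ n`, the coefficient of `X^(n-k)` in the
characteristic polynomial of the `n × n` matrix with entries `min(i, j)` equals
`(-1)^k · C(n + k, n - k)`. -/
theorem charpoly_coeff_min_matrix (n k : ℕ) (hn : 0 < n) (hk : k ≤ n) :
    ((Matrix.of fun i j : Fin n => (min (i.val + 1) (j.val + 1) : ℤ)).charpoly).coeff (n - k)
      = (-1) ^ k * ((n + k).choose (n - k) : ℤ) := by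
  rw [charpoly_min_eq_det_minPencil, coeff_det_minPencil, show 2 * n - (n - k) = n + k by omega,
    show n + (n - k) = k + 2 * (n - k) by omega, pow_add, pow_mul]
  simp
end

section
/- For all positive integers n and all integers k with 1 ≤ k ≤ n, the k-th elementary symmetric function of the eigenvalues of A_n satisfies S_k^n = Σ_{i=1}^{n−k+1} i · S_{k−1}^{n−i}, where S_k^m denotes the sum of the determinants of all k×k principal submatrices of A_m and S_0^m = 1 for every m. -/
/-- The `m × m` matrix with entries `min(i, j)` (1-indexed). -/
def Amat (m : ℕ) : Matrix (Fin m) (Fin m) ℤ :=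
  Matrix.of fun i j => (min (i.val + 1) (j.val + 1) : ℤ)

/-- `S k m` is the sum of the determinants of all `k × k` principal submatrices of `Amat m`
(for `k = 0` this is `1`, the determinant of the empty matrix). -/
def S (k m : ℕ) : ℤ :=
  ∑ T ∈ Finset.powersetCard k (Finset.univ : Finset (Fin m)),
    ((Amat m).submatrix (fun a : {x // x ∈ T} => (a : Fin m))
      (fun a : {x // x ∈ T} => (a : Fin m))).det

open Finset

namespace Matrix

variable {ι κ R : Type*} [DecidableEq ι] [DecidableEq κ] [CommRing R]

/-- The determinant of the principal submatrix of `M` with rows and columns in `T`. -/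
def principalMinor (M : Matrix ι ι R) (T : Finset ι) : R :=
  (M.submatrix (fun a : {x // x ∈ T} => (a : ι)) (fun a : {x // x ∈ T} => (a : ι))).det

/-- The sum of all `k × k` principal minors of `M`. -/
def sumPrincipalMinors [Fintype ι] (k : ℕ) (M : Matrix ι ι R) : R :=
  ∑ T ∈ powersetCard k univ, M.principalMinor T

theorem principalMinor_map (M : Matrix ι ι R) (e : κ ↪ ι) (T : Finset κ) :
    M.principalMinor (T.map e) = (M.submatrix e e).principalMinor T := by
  unfold principalMinor
  rw [← det_submatrix_equiv_self (T.equivMap e)]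
  rfl

/-- A principal minor whose first row and column are constantly `c` is reduced by subtracting that
row from all the others. -/
theorem principalMinor_insert_of_const (M : Matrix ι ι R) {a : ι} {T : Finset ι} (ha : a ∉ T)
    {c : R} (haa : M a a = c) (hrow : ∀ j ∈ T, M a j = c) (hcol : ∀ i ∈ T, M i a = c) :
    M.principalMinor (insert a T) = c * (M - of fun _ _ => c).principalMinor T := by
  let e : Unit ⊕ {x // x ∈ T} ≃ {x // x ∈ insert a T} :=
    (Equiv.sumComm _ _).trans
      ((subtypeInsertEquivOption ha).trans (Equiv.optionEquivSumPUnit _)).symm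
  have hl (u : Unit) : (e (Sum.inl u) : ι) = a := rfl
  have hr (t : {x // x ∈ T}) : (e (Sum.inr t) : ι) = t := rfl
  let N := (M - of fun _ _ => c).submatrix (fun t : {x // x ∈ T} => (t : ι))
    (fun t : {x // x ∈ T} => (t : ι))
  have key : (M.submatrix (fun x : {x // x ∈ insert a T} => (x : ι))
      (fun x : {x // x ∈ insert a T} => (x : ι))).submatrix e e
      = fromBlocks 1 0 (of fun _ _ => 1) 1 *
        fromBlocks (of fun _ _ : Unit => c) (of fun _ _ => c) 0 N := by
    rw [fromBlocks_multiply]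
    ext (i | i) (j | j)
    · simp [hl, haa]
    · simp [hl, hr, hrow]
    · simp [hl, hr, hcol, mul_apply]
    · simp [hr, N, mul_apply]
  unfold principalMinor
  rw [← det_submatrix_equiv_self e, key, det_mul, det_fromBlocks_zero₁₂, det_fromBlocks_zero₂₁]
  simp [N]

theorem sumPrincipalMinors_succ_fin {m : ℕ} (k : ℕ) (M : Matrix (Fin (m + 1)) (Fin (m + 1)) R)
    {c : R} (hrow : ∀ j, M 0 j = c) (hcol : ∀ i, M i 0 = c) :
    M.sumPrincipalMinors (k + 1) =
      c * (M.submatrix Fin.succ Fin.succ - of fun _ _ => c).sumPrincipalMinors k +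
        (M.submatrix Fin.succ Fin.succ).sumPrincipalMinors (k + 1) := by
  have h0 (T : Finset (Fin m)) : (0 : Fin (m + 1)) ∉ T.map (Fin.succEmb m) := by simp
  have huniv : (univ : Finset (Fin (m + 1))) =
      insert 0 (univ.map (Fin.succEmb m)) := by
    ext i
    cases i using Fin.cases <;> simp
  unfold sumPrincipalMinors
  rw [huniv, powersetCard_succ_insert (h0 _), sum_union, add_comm, sum_image]
  · simp only [powersetCard_map, sum_map, mul_sum]
    congr 1
    · refine sum_congr rfl fun T _ => ?_
      refine (principalMinor_insert_of_const M (h0 T) (hrow 0) (fun j _ => hrow j)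
        fun i _ => hcol i).trans ?_
      exact congrArg (c * ·) (principalMinor_map _ (Fin.succEmb m) T)
    · exact sum_congr rfl fun T _ => principalMinor_map _ (Fin.succEmb m) T
  · intro s hs t ht hst
    have hs0 : 0 ∉ s := fun h => h0 _ ((mem_powersetCard.1 hs).1 h)
    have ht0 : 0 ∉ t := fun h => h0 _ ((mem_powersetCard.1 ht).1 h)
    rw [← erase_insert hs0, ← erase_insert ht0]
    exact congrArg (erase · 0) hst
  · rw [disjoint_left]
    intro s hs hs'
    obtain ⟨t, -, rfl⟩ := mem_image.1 hs'
    exact h0 _ ((mem_powersetCard.1 hs).1 (mem_insert_self _ _))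

end Matrix

open Matrix

theorem S_eq_sumPrincipalMinors (k m : ℕ) : S k m = (Amat m).sumPrincipalMinors k := rfl

theorem S_eq_zero_of_lt {k m : ℕ} (h : m < k) : S k m = 0 := by
  rw [S, powersetCard_eq_empty.2 (by simpa using h), sum_empty]

theorem sumPrincipalMinors_Amat_add_const (k m : ℕ) (c : ℤ) :
    (Amat m + of fun _ _ => c).sumPrincipalMinors (k + 1) =
      ∑ i ∈ range m, ((i : ℤ) + 1 + c) * S k (m - 1 - i) := by
  induction m generalizing c with
  | zero => rw [sumPrincipalMinors, powersetCard_eq_empty.2 (by simp), sum_empty, range_zero, sum_empty]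
  | succ m ih =>
    have hsub : (Amat (m + 1) + of fun _ _ => c).submatrix Fin.succ Fin.succ =
        Amat m + of fun _ _ => c + 1 := by
      ext i j
      simp only [Amat, submatrix_apply, Matrix.add_apply, of_apply, Fin.val_succ]
      push_cast
      omega
    rw [sumPrincipalMinors_succ_fin k _ (c := c + 1), hsub, ih (c + 1), sum_range_succ', add_comm,
      add_sub_cancel_right, ← S_eq_sumPrincipalMinors]
    · congr 1
      · refine sum_congr rfl fun i _ => ?_
        rw [show m + 1 - 1 - (i + 1) = m - 1 - i by omega]
        push_cast
        ring
      · simp [add_comm]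
    · intro j
      simp only [Amat, Matrix.add_apply, of_apply, Fin.val_zero]
      omega
    · intro i
      simp only [Amat, Matrix.add_apply, of_apply, Fin.val_zero]
      omega

theorem S_succ (k n : ℕ) : S (k + 1) n = ∑ i ∈ range n, ((i : ℤ) + 1) * S k (n - 1 - i) := by
  have h := sumPrincipalMinors_Amat_add_const k n 0
  have h0 : (of fun _ _ => 0 : Matrix (Fin n) (Fin n) ℤ) = 0 := rfl
  simpa only [h0, add_zero, ← S_eq_sumPrincipalMinors] using h

/-- For `1 ≤ k ≤ n`, the `k`-th elementary symmetric function of the eigenvalues of `A_n`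
satisfies `S_k^n = Σ_{i=1}^{n-k+1} i · S_{k-1}^{n-i}`. -/
theorem S_recurrence (n k : ℕ) (hn : 0 < n) (hk1 : 1 ≤ k) (hkn : k ≤ n) :
    S k n = ∑ i ∈ Finset.Icc 1 (n - k + 1), (i : ℤ) * S (k - 1) (n - i) := by
  obtain ⟨k, rfl⟩ := Nat.exists_eq_add_of_le' hk1
  rw [S_succ, ← sum_subset (range_subset_range.2 (Nat.sub_le n k)), ← Ico_add_one_right_eq_Icc,
    sum_Ico_eq_sum_range]
  · refine sum_congr (congrArg range (by omega)) fun i _ => ?_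
    rw [show n - 1 - i = n - (1 + i) by omega, Nat.add_sub_cancel]
    push_cast
    ring
  · intro i hi hi'
    rw [mem_range] at hi hi'
    rw [S_eq_zero_of_lt (by omega), mul_zero]
end

section
/- For every positive integer n, 1 + Σ_{k=1}^{n} S_k^n = F_{2n+1}, where S_k^n is the sum of the determinants of all k×k principal submatrices of the n×n matrix A_n with entries min(i,j), and F_{2n+1} is the (2n+1)-st Fibonacci number. -/
open Polynomial in
/-- The sum of all principal minors of positive order of `M`, plus one, is `det (1 + M)`. -/
theorem det_one_add_eq_one_add_sum_minors {R : Type*} [CommRing R] {n : ℕ}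
    (M : Matrix (Fin n) (Fin n) R) :
    (1 + M).det = 1 + ∑ k ∈ Finset.Icc 1 n, ∑ T ∈ Finset.powersetCard k Finset.univ,
      (M.submatrix (Subtype.val : {x // x ∈ T} → Fin n) Subtype.val).det := by
  set p : R[X] := (1 + (X : R[X]) • M.map C).det with hp
  have h_deg : p.natDegree < n + 1 := by
    refine Nat.lt_succ_of_le (natDegree_le_iff_coeff_eq_zero.2 fun k hk => ?_)
    rw [hp, Matrix.coeff_det_one_add_X_smul_eq_sum_minors,
      Finset.powersetCard_eq_empty.2 (by simpa using hk), Finset.sum_empty]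
  have h_eval : p.eval 1 = (1 + M).det := by
    rw [hp, ← coe_evalRingHom, RingHom.map_det]
    congr 1
    ext i j
    by_cases h : i = j <;> simp [h]
  rw [← h_eval, eval_eq_sum_range' h_deg, Finset.range_eq_Ico,
    Finset.sum_eq_sum_Ico_succ_bot n.succ_pos]
  simp only [hp, Matrix.coeff_det_one_add_X_smul_eq_sum_minors, one_pow, mul_one]
  simp only [Finset.powersetCard_zero, Finset.sum_singleton, Matrix.det_isEmpty]
  rfl

/-- The matrix `1 + A + c J`, with `A` the matrix of `min (i, j)` and `J` the all-ones matrix. -/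
def oneAddMinAdd (c : ℚ) (n : ℕ) : Matrix (Fin n) (Fin n) ℚ :=
  Matrix.of fun i j => (if i = j then 1 else 0) + (min (i.val : ℚ) j.val + 1) + c

theorem det_oneAddMinAdd_succ {c : ℚ} (hc : c + 2 ≠ 0) (n : ℕ) :
    (oneAddMinAdd c (n + 1)).det = (c + 2) * (oneAddMinAdd ((c + 1) / (c + 2)) n).det := by
  let r : Fin (n + 1) → ℚ := Fin.cons 0 fun _ => (c + 1) / (c + 2)
  rw [Matrix.det_eq_of_forall_row_eq_smul_add_const (A := oneAddMinAdd c (n + 1))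
    (B := Matrix.of fun i j => oneAddMinAdd c (n + 1) i j - r i * oneAddMinAdd c (n + 1) 0 j)
    r 0 rfl (by intro i j; simp [r]), Matrix.det_succ_column_zero, Fin.sum_univ_succ,
    Finset.sum_eq_zero, add_zero]
  · congr 1
    · simp [oneAddMinAdd, r]
      ring
    · congr 1
      ext i j
      have h_min : min ((i.val : ℚ) + 1) (j.val + 1) = min (i.val : ℚ) j.val + 1 :=
        min_add_add_right _ _ _
      simp [oneAddMinAdd, r, h_min, (Fin.succ_ne_zero _).symm]
      field_simp
      ring
  · intro i _
    have h_nonneg : (0 : ℚ) ≤ (i.val : ℚ) + 1 := by positivity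
    have h_zero : c + 1 - (c + 1) / (c + 2) * (1 + 1 + c) = 0 := by
      field_simp
      ring
    simp [oneAddMinAdd, r, h_nonneg, add_comm 1 c, h_zero]

theorem fib_mul_det_oneAddMinAdd (n k : ℕ) :
    (Nat.fib (2 * k + 1) : ℚ) *
        (oneAddMinAdd (Nat.fib (2 * k) / Nat.fib (2 * k + 1)) n).det =
      Nat.fib (2 * (n + k) + 1) := by
  induction n generalizing k with
  | zero => simp
  | succ n ih =>
    have h_pos : (0 : ℚ) < Nat.fib (2 * k + 1) := by
      exact_mod_cast Nat.fib_pos.2 (Nat.succ_pos _)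
    have h_even : (Nat.fib (2 * (k + 1)) : ℚ) = Nat.fib (2 * k) + Nat.fib (2 * k + 1) := by
      exact_mod_cast Nat.fib_add_two (n := 2 * k)
    have h_odd : (Nat.fib (2 * (k + 1) + 1) : ℚ) =
        Nat.fib (2 * k) + 2 * Nat.fib (2 * k + 1) := by
      have h : (Nat.fib (2 * (k + 1) + 1) : ℚ) =
          Nat.fib (2 * k + 1) + Nat.fib (2 * (k + 1)) := by
        exact_mod_cast Nat.fib_add_two (n := 2 * k + 1)
      rw [h, h_even]
      ring
    have h_ne : (Nat.fib (2 * k) : ℚ) + 2 * Nat.fib (2 * k + 1) ≠ 0 := by positivity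
    have h_step := ih (k + 1)
    rw [show n + (k + 1) = n + 1 + k by ring] at h_step
    rw [det_oneAddMinAdd_succ (by positivity), ← h_step, ← mul_assoc, h_odd, h_even]
    congr 1
    · field_simp
    · congr 2
      field_simp

theorem det_one_add_Amat (n : ℕ) : (1 + Amat n).det = (Nat.fib (2 * n + 1) : ℤ) := by
  have h := fib_mul_det_oneAddMinAdd n 0
  have h_map : (1 + Amat n).map (Int.castRingHom ℚ) = oneAddMinAdd 0 n := by
    ext i j
    simp [oneAddMinAdd, Amat, Matrix.one_apply, min_add_add_right]
  have h_det := (Int.castRingHom ℚ).map_det (1 + Amat n)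
  rw [RingHom.mapMatrix_apply, h_map, eq_intCast] at h_det
  simp only [mul_zero, zero_add, Nat.fib_zero, Nat.fib_one, Nat.cast_zero, Nat.cast_one,
    zero_div, one_mul, add_zero, ← h_det] at h
  exact_mod_cast h

/-- For every positive integer `n`, `1 + Σ_{k=1}^{n} S_k^n = F_{2n+1}`, where `S_k^n` is
the sum of the determinants of all `k × k` principal submatrices of the `n × n` matrix with
entries `min(i, j)`, and `F` is the Fibonacci sequence with `F 1 = F 2 = 1`. -/
theorem one_add_sum_S_eq_fib (n : ℕ) (hn : 0 < n) :
    1 + ∑ k ∈ Finset.Icc 1 n, S k n = (Nat.fib (2 * n + 1) : ℤ) := by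
  exact (det_one_add_eq_one_add_sum_minors (Amat n)).symm.trans (det_one_add_Amat n)
end

section
/- For all integers n ≥ 2 and all integers k with 1 ≤ k ≤ n−1, the elementary symmetric functions of the eigenvalues of A_n and A_{n−1} satisfy (n−k) · S_k^n = (n+k) · S_k^{n−1}. -/
/-- The principal minor of the kernel `K` on the finset `T`. -/
def principalMinor {α : Type*} [DecidableEq α] (K : α → α → ℤ) (T : Finset α) : ℤ :=
  (Matrix.of fun i j : {x // x ∈ T} => K i j).det

theorem principalMinor_map {α β : Type*} [DecidableEq α] [DecidableEq β] (e : α ↪ β)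
    (K : β → β → ℤ) (T : Finset α) :
    principalMinor K (T.map e) = principalMinor (fun i j => K (e i) (e j)) T := by
  unfold principalMinor
  let f : {x // x ∈ T} → {y // y ∈ T.map e} := fun x => ⟨e x, Finset.mem_map_of_mem e x.2⟩
  have hf : Function.Bijective f := by
    refine ⟨fun x y h => Subtype.ext (e.injective (congrArg Subtype.val h)), fun y => ?_⟩
    obtain ⟨x, hx, h⟩ := Finset.mem_map.1 y.2
    exact ⟨⟨x, hx⟩, Subtype.ext h⟩
  rw [← Matrix.det_submatrix_equiv_self (Equiv.ofBijective f hf)]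
  rfl

theorem det_fromBlocks_const {ι : Type*} [Fintype ι] [DecidableEq ι] (c : ℤ) (N : Matrix ι ι ℤ) :
    (Matrix.fromBlocks N (Matrix.of fun _ _ => c) (Matrix.of fun _ _ => c)
      (Matrix.of fun _ _ : PUnit => c)).det = c * (Matrix.of fun i j => N i j - c).det := by
  have h : Matrix.fromBlocks N (Matrix.of fun _ _ => c) (Matrix.of fun _ _ => c)
      (Matrix.of fun _ _ : PUnit => c) =
      Matrix.fromBlocks 1 (Matrix.of fun _ _ => 1) 0 1 *
        Matrix.fromBlocks (Matrix.of fun i j => N i j - c) 0 (Matrix.of fun _ _ => c)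
          (Matrix.of fun _ _ : PUnit => c) := by
    rw [Matrix.fromBlocks_multiply]
    congr 1 <;> ext i j <;> simp [Matrix.mul_apply]
  rw [h, Matrix.det_mul, Matrix.det_fromBlocks_zero₂₁, Matrix.det_fromBlocks_zero₁₂]
  simp [mul_comm]

theorem principalMinor_insert {α : Type*} [DecidableEq α] (K : α → α → ℤ) (c : ℤ) {a : α}
    {T : Finset α} (ha : a ∉ T) (haa : K a a = c) (hrow : ∀ j ∈ T, K a j = c)
    (hcol : ∀ i ∈ T, K i a = c) :
    principalMinor K (insert a T) = c * principalMinor (fun i j => K i j - c) T := by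
  unfold principalMinor
  rw [← Matrix.det_submatrix_equiv_self
    ((Finset.subtypeInsertEquivOption ha).trans (Equiv.optionEquivSumPUnit.{0} _)).symm]
  refine Eq.trans ?_ (det_fromBlocks_const c (Matrix.of fun i j : {x // x ∈ T} => K i j))
  congr 1
  ext (i | i) (j | j)
  · simp [Finset.subtypeInsertEquivOption]
  · simpa [Finset.subtypeInsertEquivOption] using hcol i i.2
  · simpa [Finset.subtypeInsertEquivOption] using hrow j j.2
  · simpa [Finset.subtypeInsertEquivOption] using haa

/-- The sum of the `k × k` principal minors of the matrix with entries `min(i, j) + x`. -/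
def shiftedMinorSum (k m : ℕ) (x : ℤ) : ℤ :=
  ∑ T ∈ Finset.powersetCard k (Finset.univ : Finset (Fin m)),
    principalMinor (fun i j => min (i.val + 1 : ℤ) (j.val + 1) + x) T

theorem shiftedMinorSum_succ_succ (k m : ℕ) (x : ℤ) :
    shiftedMinorSum (k + 1) (m + 1) x =
      shiftedMinorSum (k + 1) m (x + 1) + (1 + x) * shiftedMinorSum k m 0 := by
  have h0 : (0 : Fin (m + 1)) ∉
      (Finset.univ : Finset (Fin m)).map ⟨Fin.succ, Fin.succ_injective m⟩ := by simp
  unfold shiftedMinorSum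
  rw [Fin.univ_succ, Finset.cons_eq_insert, Finset.powersetCard_succ_insert h0,
    Finset.sum_union, Finset.sum_image, Finset.powersetCard_map, Finset.sum_map,
    Finset.powersetCard_map, Finset.sum_map, Finset.mul_sum]
  · congr 1
    · refine Finset.sum_congr rfl fun T _ => ?_
      simp only [Finset.mapEmbedding_apply, RelEmbedding.coe_toEmbedding, principalMinor_map]
      congr 1
      funext i j
      simp
      omega
    · refine Finset.sum_congr rfl fun T _ => ?_
      simp only [Finset.mapEmbedding_apply, RelEmbedding.coe_toEmbedding]
      rw [principalMinor_insert _ (1 + x) (by simp), principalMinor_map]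
      · congr 2
        funext i j
        simp
      · simp
      · intro j _
        simp
      · intro j _
        simp
  · intro T hT U hU h
    have hT' : (0 : Fin (m + 1)) ∉ T := fun h => h0 ((Finset.mem_powersetCard.1 hT).1 h)
    have hU' : (0 : Fin (m + 1)) ∉ U := fun h => h0 ((Finset.mem_powersetCard.1 hU).1 h)
    rw [← Finset.erase_insert hT', ← Finset.erase_insert hU', h]
  · refine Finset.disjoint_left.2 fun T hT hT' => ?_
    obtain ⟨U, -, rfl⟩ := Finset.mem_image.1 hT'
    exact h0 ((Finset.mem_powersetCard.1 hT).1 (Finset.mem_insert_self _ _))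

theorem shiftedMinorSum_zero (m : ℕ) (x : ℤ) : shiftedMinorSum 0 m x = 1 := by
  simp [shiftedMinorSum, principalMinor]

theorem shiftedMinorSum_succ (m : ℕ) : ∀ (k : ℕ) (x : ℤ), shiftedMinorSum (k + 1) m x =
    (m + k + 1).choose (2 * k + 2) + x * (m + k).choose (2 * k + 1) := by
  induction m with
  | zero =>
    intro k x
    rw [Nat.choose_eq_zero_of_lt (by omega), Nat.choose_eq_zero_of_lt (by omega)]
    rw [shiftedMinorSum, Finset.powersetCard_eq_empty.2 (by simp)]
    simp
  | succ m ih =>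
    intro k x
    have h : shiftedMinorSum k m 0 = (m + k).choose (2 * k) := by
      cases k with
      | zero => simp [shiftedMinorSum_zero]
      | succ k => rw [ih]; simp [mul_add, add_assoc]
    rw [shiftedMinorSum_succ_succ, ih, h, show m + 1 + k + 1 = m + k + 1 + 1 by ring,
      show m + 1 + k = m + k + 1 by ring, Nat.choose_succ_succ (m + k + 1) (2 * k + 1),
      Nat.choose_succ_succ (m + k) (2 * k)]
    push_cast
    simp only [Nat.succ_eq_add_one]
    ring

theorem S_succ_eq_choose (k m : ℕ) : S (k + 1) m = (m + k + 1).choose (2 * k + 2) := by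
  have h : S (k + 1) m = shiftedMinorSum (k + 1) m 0 := by
    simp only [S, shiftedMinorSum, principalMinor, add_zero]
    rfl
  simp [h, shiftedMinorSum_succ]

/-- For `n ≥ 2` and `1 ≤ k ≤ n - 1`, the elementary symmetric functions of the eigenvalues
of `A_n` and `A_{n-1}` satisfy `(n - k) · S_k^n = (n + k) · S_k^{n-1}`. -/
theorem S_ratio (n k : ℕ) (hn : 2 ≤ n) (hk1 : 1 ≤ k) (hkn : k ≤ n - 1) :
    ((n - k : ℕ) : ℤ) * S k n = ((n + k : ℕ) : ℤ) * S k (n - 1) := by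
  obtain ⟨k, rfl⟩ := Nat.exists_eq_add_of_le' hk1
  obtain ⟨n, rfl⟩ := Nat.exists_eq_add_of_le' (show 1 ≤ n by omega)
  rw [S_succ_eq_choose, S_succ_eq_choose, Nat.add_sub_cancel]
  have h := Nat.choose_mul_succ_eq (n + k + 1) (2 * k + 2)
  rw [show n + k + 1 + 1 - (2 * k + 2) = n + 1 - (k + 1) by omega] at h
  rw [show n + 1 + k + 1 = n + k + 1 + 1 by ring, show n + 1 + (k + 1) = n + k + 1 + 1 by ring]
  exact_mod_cast by linarith
end

section
/- For all integers n, k with 1 ≤ k ≤ n, the binomial identity C(n+k, n−k) = Σ_{i=1}^{n−k+1} i · C(n−i+k−1, n−i−k+1) holds (with the convention that C(a, b) = 0 when b < 0 or b > a). -/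
/-- The twice-iterated hockey-stick identity. -/
theorem sum_range_mul_add_choose (m r : ℕ) :
    ∑ s ∈ Finset.range (m + 1), (m + 1 - s) * (s + r).choose r = (m + r + 2).choose (r + 2) := by
  induction m with
  | zero => simp
  | succ m ih =>
    have split_weight : ∑ s ∈ Finset.range (m + 2), (m + 2 - s) * (s + r).choose r
        = ∑ s ∈ Finset.range (m + 2), (m + 1 - s) * (s + r).choose r
          + ∑ s ∈ Finset.range (m + 2), (s + r).choose r := by
      rw [← Finset.sum_add_distrib]
      refine Finset.sum_congr rfl fun s hs => ?_
      have hs' : m + 2 - s = (m + 1 - s) + 1 := by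
        have := Finset.mem_range.mp hs
        omega
      rw [hs', Nat.add_one_mul]
    rw [split_weight, Nat.sum_range_add_choose, Finset.sum_range_succ, ih, Nat.sub_self, zero_mul,
      add_zero, show m + 1 + r + 2 = (m + r + 2) + 1 by omega,
      show m + 1 + r + 1 = m + r + 2 by omega, Nat.choose_succ_succ' (m + r + 2) (r + 1), add_comm]

/-- For `1 ≤ k ≤ n`, the binomial identity
`C(n+k, n-k) = Σ_{i=1}^{n-k+1} i · C(n-i+k-1, n-i-k+1)` holds
(all the lower indices appearing in the sum are nonnegative, and `Nat.choose a b = 0`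
when `b > a`, matching the stated convention). -/
theorem binomial_weighted_sum (n k : ℕ) (hk1 : 1 ≤ k) (hkn : k ≤ n) :
    (n + k).choose (n - k)
      = ∑ i ∈ Finset.Icc 1 (n - k + 1), i * (n + k - 1 - i).choose (n + 1 - k - i) := by
  obtain ⟨m, rfl⟩ := Nat.exists_eq_add_of_le hkn
  obtain ⟨j, rfl⟩ := Nat.exists_eq_add_of_le hk1
  rw [Nat.add_sub_cancel_left, Nat.choose_symm_of_eq_add (b := 2 * j + 2) (by omega),
    show 1 + j + m + (1 + j) = m + 2 * j + 2 by omega, ← sum_range_mul_add_choose]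
  refine Finset.sum_bij' (fun s _ => m + 1 - s) (fun i _ => m + 1 - i) ?_ ?_ ?_ ?_ ?_
  iterate 4
    intro s hs
    simp only [Finset.mem_range, Finset.mem_Icc] at hs ⊢
    omega
  intro s hs
  have hs' := Finset.mem_range.mp hs
  rw [show m + 2 * j + 2 - 1 - (m + 1 - s) = s + 2 * j by omega,
    show 1 + j + m + 1 - (1 + j) - (m + 1 - s) = s by omega,
    Nat.choose_symm_add]
end

section
/- For every positive integer n, the sum over all k from 0 to n of the sums of determinants of all k×k principal submatrices of A_n (with the k = 0 term equal to 1) equals the determinant of I + A_n, and hence det(I + A_n) = F_{2n+1}. -/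
/-- The tridiagonal matrix with all off-diagonal entries equal to `-1`, first diagonal entry `a`,
and remaining diagonal entries `3`. -/
def tridiagonal (a : ℤ) (m : ℕ) : Matrix (Fin m) (Fin m) ℤ :=
  Matrix.of fun i j =>
    if i = j then (if i.val = 0 then a else 3)
    else if i.val = j.val + 1 ∨ j.val = i.val + 1 then -1 else 0

theorem tridiagonal_submatrix_succ (a : ℤ) (m : ℕ) :
    (tridiagonal a (m + 1)).submatrix Fin.succ Fin.succ = tridiagonal 3 m := by
  ext i j
  simp [tridiagonal]

theorem det_tridiagonal_add_two (a : ℤ) (m : ℕ) :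
    (tridiagonal a (m + 2)).det =
      a * (tridiagonal 3 (m + 1)).det - (tridiagonal 3 m).det := by
  have minor : ((tridiagonal a (m + 2)).submatrix Fin.succ (Fin.succAbove 1)).det =
      -(tridiagonal 3 m).det := by
    rw [Matrix.det_succ_column_zero, Fin.sum_univ_succ, Finset.sum_eq_zero]
    · have corner : ((tridiagonal a (m + 2)).submatrix Fin.succ (Fin.succAbove 1)).submatrix
          (Fin.succAbove 0) Fin.succ = tridiagonal 3 m := by
        ext i j
        have h : (1 : Fin (m + 2)).succAbove j.succ = j.succ.succ := by
          rw [← Fin.succ_zero_eq_one, Fin.succ_succAbove_succ, Fin.succAbove_zero]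
        simp [tridiagonal, h]
      rw [corner]
      simp [tridiagonal]
    · intro i _
      simp [tridiagonal]
  rw [Matrix.det_succ_row_zero, Fin.sum_univ_succ, Fin.sum_univ_succ, Finset.sum_eq_zero]
  · rw [Fin.succ_zero_eq_one, minor, Fin.succAbove_zero, tridiagonal_submatrix_succ]
    simp [tridiagonal]
    ring
  · intro i _
    have entry : tridiagonal a (m + 2) 0 i.succ.succ = 0 := by
      simp only [tridiagonal, Matrix.of_apply, Fin.ext_iff, Fin.val_succ, Fin.val_zero]
      grind
    rw [entry, mul_zero, zero_mul]

theorem det_tridiagonal_three (m : ℕ) :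
    (tridiagonal 3 m).det = (Nat.fib (2 * m + 2) : ℤ) := by
  induction m using Nat.twoStepInduction with
  | zero => simp
  | one => simp [tridiagonal, Nat.fib_add_two]
  | more m ih₀ ih₁ =>
    rw [det_tridiagonal_add_two, ih₀, ih₁]
    simp only [Nat.mul_add, Nat.mul_one, Nat.add_assoc, Nat.reduceAdd, Nat.reduceMul]
    push_cast [Nat.fib_add_two (n := 2 * m + 4), Nat.fib_add_two (n := 2 * m + 3),
      Nat.fib_add_two (n := 2 * m + 2)]
    ring

theorem det_tridiagonal_two (m : ℕ) :
    (tridiagonal 2 (m + 1)).det = (Nat.fib (2 * m + 3) : ℤ) := by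
  cases m with
  | zero => simp [tridiagonal, Nat.fib_add_two]
  | succ m =>
    rw [det_tridiagonal_add_two, det_tridiagonal_three, det_tridiagonal_three]
    simp only [Nat.mul_add, Nat.mul_one, Nat.add_assoc, Nat.reduceAdd]
    push_cast [Nat.fib_add_two (n := 2 * m + 3), Nat.fib_add_two (n := 2 * m + 2)]
    ring

theorem det_one_add_Amat_eq_det_tridiagonal (m : ℕ) :
    (1 + Amat (m + 1)).det = (tridiagonal 2 (m + 1)).det := by
  let R : Matrix (Fin (m + 1)) (Fin (m + 1)) ℤ := Matrix.of fun i j =>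
    (if i = j then 1 else 0) - (if i.val = j.val + 1 then 1 else 0) + (if i ≤ j then 1 else 0)
  trans R.det
  · refine Matrix.det_eq_of_forall_row_eq_smul_add_pred (fun _ => 1) ?_ ?_
    · intro j
      simp [R, Amat, Matrix.one_apply]
    · intro i j
      simp only [R, Amat, Matrix.one_apply, Matrix.add_apply, Matrix.of_apply, Fin.ext_iff,
        Fin.le_def, Fin.val_succ, Fin.val_castSucc]
      grind
  · refine Matrix.det_eq_of_forall_col_eq_smul_add_pred (fun _ => 1) ?_ ?_
    · intro i
      simp only [R, tridiagonal, Matrix.of_apply, Fin.ext_iff, Fin.le_def, Fin.val_zero]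
      grind
    · intro i j
      simp only [R, tridiagonal, Matrix.of_apply, Fin.ext_iff, Fin.le_def, Fin.val_succ,
        Fin.val_castSucc]
      grind

/-- The determinant of `1 + M` is the sum of all principal minors of `M`. -/
theorem det_one_add_eq_sum_principal_minors {ι R : Type*} [Fintype ι] [DecidableEq ι]
    [CommRing R] (M : Matrix ι ι R) :
    (1 + M).det = ∑ s : Finset ι, (M.submatrix (Subtype.val : s → ι) Subtype.val).det := by
  rw [add_comm]
  refine (Matrix.detRowAlternating.map_add_univ M.row (1 : Matrix ι ι R).row).trans ?_
  exact Finset.sum_congr rfl fun s _ => Matrix.det_piecewise_one_eq_submatrix_det M s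

theorem sum_S_eq_det_one_add_Amat (n : ℕ) :
    ∑ k ∈ Finset.range (n + 1), S k n = (1 + Amat n).det := by
  rw [det_one_add_eq_sum_principal_minors, ← Finset.powerset_univ, Finset.sum_powerset,
    Finset.card_univ, Fintype.card_fin]
  rfl

/-- For every positive integer `n`, the sum `Σ_{k=0}^{n} S_k^n` of the sums of determinants
of all `k × k` principal submatrices of `A_n` equals `det (I + A_n)`, and hence
`det (I + A_n) = F_{2n+1}`. -/
theorem det_one_add_min_matrix (n : ℕ) (hn : 0 < n) :
    (∑ k ∈ Finset.range (n + 1), S k n) = (1 + Amat n).det ∧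
      (1 + Amat n).det = (Nat.fib (2 * n + 1) : ℤ) := by
  refine ⟨sum_S_eq_det_one_add_Amat n, ?_⟩
  obtain ⟨m, rfl⟩ := Nat.exists_eq_succ_of_ne_zero hn.ne'
  exact (det_one_add_Amat_eq_det_tridiagonal m).trans (det_tridiagonal_two m)
end
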